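/- arXiv:1912.07989 — 2 statements merged into one kernel-verified Lean document; each statement's English description precedes it below -/
import Mathlib

section
/- For every integer n ≥ 0 and every a > 0, ∫₀^∞ x^{2n+1} cos(ax)/(e^x - 1) dx = (-1)^n · d^{2n+1}/da^{2n+1} [ (π/2)·coth(aπ) - 1/(2a) ]. -/
noncomputable def coth (x : ℝ) : ℝ := Real.cosh x / Real.sinh x

open Complex UpperHalfPlane in
lemma contDiffOn_pi_mul_cot_sub_inv (m : ℕ∞) :
    ContDiffOn ℂ m (fun z : ℂ ↦ Real.pi * cot (Real.pi * z) - 1 / z) upperHalfPlaneSet := by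
  intro z hz
  have hz' : z ∈ integerComplement := coe_mem_integerComplement ⟨z, hz⟩
  have h0 : z ≠ 0 := UpperHalfPlane.ne_zero ⟨z, hz⟩
  have h1 : ContDiffWithinAt ℂ m (fun z : ℂ ↦ cot (Real.pi * z)) upperHalfPlaneSet z :=
    cot_pi_mul_contDiffWithinAt m hz'
  exact (contDiffWithinAt_const.mul h1).sub (contDiffWithinAt_const.div contDiffWithinAt_id h0)

open Complex in
lemma half_pi_coth_sub_eq_re (b : ℝ) :
    Real.pi / 2 * coth (b * Real.pi) - 1 / (2 * b) =
      (I / 2 * (Real.pi * cot (Real.pi * (I * b)) - 1 / (I * b))).re := by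
  have h : (I / 2 * (Real.pi * cot (Real.pi * (I * b)) - 1 / (I * b))) =
      ((Real.pi / 2 * coth (b * Real.pi) - 1 / (2 * b) : ℝ) : ℂ) := by
    have h1 : (Real.pi * (I * b) : ℂ) = ((b * Real.pi : ℝ) : ℂ) * I := by push_cast; ring
    rw [h1, Complex.cot, Complex.cos_mul_I, Complex.sin_mul_I, coth]
    have e1 : (1 : ℂ) / (I * b) = -I * (b : ℂ)⁻¹ := by
      rw [one_div, mul_inv, Complex.inv_I]
    have e2 (x y : ℂ) : x / (y * I) = -I * (x / y) := by
      rw [div_mul_eq_div_div, Complex.div_I]; ring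
    rw [e1, e2]
    push_cast
    have e3 : (1 : ℂ) / (2 * b) = (b : ℂ)⁻¹ / 2 := by rw [one_div, mul_inv]; ring
    rw [e3]
    linear_combination
      (-(Real.pi / 2 * (Complex.cosh (b * Real.pi) / Complex.sinh (b * Real.pi))) + (b : ℂ)⁻¹ / 2) *
        Complex.I_sq
  rw [h, Complex.ofReal_re]

open Complex in
open UpperHalfPlane hiding I in
lemma iteratedDeriv_re_comp_I_mul {G : ℂ → ℂ} (hG : ∀ m : ℕ, ContDiffOn ℂ m G upperHalfPlaneSet)
    (c : ℂ) (k : ℕ) {b : ℝ} (hb : 0 < b) :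
    iteratedDeriv k (fun b : ℝ ↦ (c * G (I * b)).re) b =
      (c * I ^ k * iteratedDerivWithin k G upperHalfPlaneSet (I * b)).re := by
  induction k generalizing b with
  | zero => simp
  | succ k ih =>
    have hz : (I * b : ℂ) ∈ upperHalfPlaneSet := by simpa using hb
    have hev : iteratedDeriv k (fun b : ℝ ↦ (c * G (I * b)).re) =ᶠ[nhds b]
        fun b : ℝ ↦ (c * I ^ k * iteratedDerivWithin k G upperHalfPlaneSet (I * b)).re := by
      filter_upwards [lt_mem_nhds hb] with x hx using ih hx
    rw [iteratedDeriv_succ, hev.deriv_eq]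
    have hd : HasDerivAt (iteratedDerivWithin k G upperHalfPlaneSet)
        (iteratedDerivWithin (k + 1) G upperHalfPlaneSet (I * b)) (I * b) := by
      have h1 := (hG (k + 1)).differentiableOn_iteratedDerivWithin (m := k)
        (by exact_mod_cast Nat.lt_succ_self k) isOpen_upperHalfPlaneSet.uniqueDiffOn
      have h2 := (h1 _ hz).hasDerivWithinAt
      rw [← iteratedDerivWithin_succ] at h2
      exact h2.hasDerivAt (isOpen_upperHalfPlaneSet.mem_nhds hz)
    have hl : HasDerivAt (fun x : ℂ ↦ I * x) I (b : ℂ) := by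
      simpa using (hasDerivAt_id (b : ℂ)).const_mul I
    have h3 := (HasDerivAt.comp (b : ℂ) hd hl).const_mul (c * I ^ k)
    have h4 := h3.real_of_complex
    rw [show c * I ^ (k + 1) * iteratedDerivWithin (k + 1) G upperHalfPlaneSet (I * b) =
      c * I ^ k * (iteratedDerivWithin (k + 1) G upperHalfPlaneSet (I * b) * I) by ring]
    exact h4.deriv

open MeasureTheory Set in
lemma integrableOn_pow_mul_exp_neg_mul (k : ℕ) {r : ℝ} (hr : 0 < r) :
    IntegrableOn (fun x : ℝ ↦ x ^ k * Real.exp (-(r * x))) (Ioi 0) := by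
  have := integrableOn_rpow_mul_exp_neg_mul_rpow (s := k) (p := 1) (b := r)
    (by linarith [(Nat.cast_nonneg k : (0 : ℝ) ≤ k)]) one_pos hr
  simpa [Real.rpow_natCast] using this

open MeasureTheory Set in
lemma integrableOn_pow_mul_cexp_neg_mul (k : ℕ) {r : ℂ} (hr : 0 < r.re) :
    IntegrableOn (fun x : ℝ ↦ (x : ℂ) ^ k * Complex.exp (-(r * x))) (Ioi 0) := by
  refine (integrableOn_pow_mul_exp_neg_mul k hr).mono'
    (by fun_prop) ?_
  filter_upwards [ae_restrict_mem measurableSet_Ioi] with x hx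
  simp [Complex.norm_exp, abs_of_pos (mem_Ioi.1 hx)]

open MeasureTheory Set Filter Topology in
lemma integral_pow_mul_cexp_neg_mul (k : ℕ) {r : ℂ} (hr : 0 < r.re) :
    ∫ x in Ioi (0 : ℝ), (x : ℂ) ^ k * Complex.exp (-(r * x)) = k.factorial / r ^ (k + 1) := by
  have hr0 : r ≠ 0 := by rintro rfl; simp at hr
  induction k with
  | zero =>
    have h := integral_exp_mul_complex_Ioi (a := -r) (by simpa using hr) 0
    simpa [neg_mul] using h
  | succ k ih =>
    have hderiv : ∀ x ∈ Ici (0 : ℝ), HasDerivAt (fun x : ℝ ↦ (x : ℂ) ^ (k + 1) *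
        Complex.exp (-(r * x))) ((k + 1) * ((x : ℂ) ^ k * Complex.exp (-(r * x))) -
          r * ((x : ℂ) ^ (k + 1) * Complex.exp (-(r * x)))) x := by
      intro x _
      have h1 : HasDerivAt (fun x : ℂ ↦ x ^ (k + 1) * Complex.exp (-(r * x)))
          ((k + 1) * ((x : ℂ) ^ k * Complex.exp (-(r * x))) -
          r * ((x : ℂ) ^ (k + 1) * Complex.exp (-(r * x)))) x := by
        have := (hasDerivAt_pow (k + 1) (x : ℂ)).mul
          (((hasDerivAt_id (x : ℂ)).const_mul r).neg.cexp)
        convert! this using 1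
        simp
        ring
      exact h1.comp_ofReal
    have hi0 := (integrableOn_pow_mul_cexp_neg_mul k hr).const_mul ((k : ℂ) + 1)
    have hi1 := (integrableOn_pow_mul_cexp_neg_mul (k + 1) hr).const_mul r
    have hlim : Tendsto (fun x : ℝ ↦ (x : ℂ) ^ (k + 1) * Complex.exp (-(r * x))) atTop (𝓝 0) := by
      rw [tendsto_zero_iff_norm_tendsto_zero]
      have h := tendsto_rpow_mul_exp_neg_mul_atTop_nhds_zero (k + 1 : ℕ) r.re hr
      refine h.congr' ?_
      filter_upwards [eventually_ge_atTop 0] with x hx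
      simp only [Real.rpow_natCast]
      simp [Complex.norm_exp, abs_of_nonneg hx]
    have key := integral_Ioi_of_hasDerivAt_of_tendsto' hderiv (hi0.sub hi1) hlim
    rw [integral_sub hi0 hi1, integral_const_mul, integral_const_mul, ih] at key
    simp only [Complex.ofReal_zero, ne_eq, Nat.add_eq_zero_iff, one_ne_zero, and_false,
      not_false_eq_true, zero_pow, zero_mul, sub_zero] at key
    rw [Nat.factorial_succ, eq_div_iff (pow_ne_zero _ hr0)]
    have h2 := eq_of_sub_eq_zero key
    push_cast
    rw [pow_succ r (k + 1), ← mul_assoc, mul_comm _ r, ← mul_assoc, ← h2]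
    field_simp

open MeasureTheory Set in
lemma integral_pow_mul_cos_mul_exp_neg_mul (k : ℕ) (a : ℝ) {r : ℝ} (hr : 0 < r) :
    ∫ x in Ioi (0 : ℝ), x ^ k * Real.cos (a * x) * Real.exp (-(r * x)) =
      (k.factorial / (r + Complex.I * a) ^ (k + 1) : ℂ).re := by
  have hr' : 0 < (r + Complex.I * a : ℂ).re := by simpa using hr
  rw [← integral_pow_mul_cexp_neg_mul k hr']
  have h := integral_re (integrableOn_pow_mul_cexp_neg_mul k hr')
  simp only [RCLike.re_to_complex] at h
  rw [← h]
  congr 1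
  ext x
  rw [← Complex.ofReal_pow, Complex.re_ofReal_mul, Complex.exp_re]
  simp
  ring

open MeasureTheory Set in
lemma hasSum_integral_pow_mul_cos_div_exp_sub_one {k : ℕ} (hk : 1 ≤ k) (a : ℝ) :
    HasSum (fun m : ℕ ↦ (k.factorial / ((m + 1 : ℝ) + Complex.I * a) ^ (k + 1) : ℂ).re)
      (∫ x in Ioi (0 : ℝ), x ^ k * Real.cos (a * x) / (Real.exp x - 1)) := by
  have hpos (m : ℕ) : (0 : ℝ) < m + 1 := by positivity
  have hbound (m : ℕ) (x : ℝ) (hx : x ∈ Ioi (0 : ℝ)) :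
      ‖x ^ k * Real.cos (a * x) * Real.exp (-((m + 1) * x))‖ ≤
        x ^ k * Real.exp (-((m + 1) * x)) := by
    have hx' : 0 < x := hx
    rw [norm_mul, norm_mul, Real.norm_eq_abs (Real.exp _), Real.abs_exp, norm_pow,
      Real.norm_of_nonneg hx'.le]
    gcongr
    exact mul_le_of_le_one_right (by positivity) (Real.abs_cos_le_one _)
  have hint (m : ℕ) : IntegrableOn
      (fun x : ℝ ↦ x ^ k * Real.cos (a * x) * Real.exp (-((m + 1) * x))) (Ioi 0) :=
    (integrableOn_pow_mul_exp_neg_mul k (hpos m)).mono' (by fun_prop)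
      ((ae_restrict_iff' measurableSet_Ioi).2 (.of_forall (hbound m)))
  have hval (m : ℕ) : ∫ x in Ioi (0 : ℝ), x ^ k * Real.exp (-((m + 1) * x)) =
      k.factorial * (1 / ((m + 1 : ℕ) : ℝ) ^ (k + 1)) := by
    have h := integral_pow_mul_cos_mul_exp_neg_mul k 0 (hpos m)
    simp only [zero_mul, Real.cos_zero, mul_one] at h
    rw [h, ← Complex.ofReal_re (k.factorial * (1 / ((m + 1 : ℕ) : ℝ) ^ (k + 1)))]
    congr 1
    push_cast
    simp [div_eq_mul_inv]
  have hsum : Summable fun m : ℕ ↦ ∫ x in Ioi (0 : ℝ),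
      ‖x ^ k * Real.cos (a * x) * Real.exp (-((m + 1) * x))‖ := by
    refine Summable.of_nonneg_of_le (fun m ↦ integral_nonneg fun x ↦ norm_nonneg _)
      (fun m ↦ setIntegral_mono_on (hint m).norm (integrableOn_pow_mul_exp_neg_mul k (hpos m))
        measurableSet_Ioi (hbound m)) ?_
    simp_rw [hval]
    exact ((summable_nat_add_iff 1).2
      (Real.summable_one_div_nat_pow.2 (by lia : 1 < k + 1))).mul_left _
  have h := hasSum_integral_of_summable_integral_norm hint hsum
  convert! h using 1
  · ext m
    rw [integral_pow_mul_cos_mul_exp_neg_mul k a (hpos m)]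
  · refine setIntegral_congr_fun measurableSet_Ioi fun x hx ↦ ?_
    have hx' : 0 < x := hx
    have hlt : Real.exp (-x) < 1 := by simpa using hx'
    have hterm (m : ℕ) : Real.exp (-((m + 1) * x)) = Real.exp (-x) * Real.exp (-x) ^ m := by
      rw [← Real.exp_nat_mul, ← Real.exp_add]
      ring_nf
    simp_rw [hterm]
    rw [tsum_mul_left, tsum_mul_left, tsum_geometric_of_lt_one (Real.exp_pos _).le hlt,
      div_eq_mul_inv]
    congr 1
    have h1 : Real.exp x - 1 ≠ 0 := (sub_pos.2 (Real.one_lt_exp_iff.2 hx')).ne'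
    rw [Real.exp_neg, ← div_eq_mul_inv, eq_comm]
    field_simp

open Complex UpperHalfPlane in
lemma hasSum_iteratedDerivWithin_cot_sub_inv_odd (n : ℕ) {z : ℂ} (hz : z ∈ upperHalfPlaneSet) :
    HasSum (fun m : ℕ ↦ -((2 * n + 1).factorial / ((m + 1 : ℝ) + z) ^ (2 * n + 1 + 1) +
        (2 * n + 1).factorial / ((m + 1 : ℝ) - z) ^ (2 * n + 1 + 1)))
      (iteratedDerivWithin (2 * n + 1)
        (fun x : ℂ ↦ Real.pi * cot (Real.pi * x) - 1 / x) upperHalfPlaneSet z) := by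
  rw [iteratedDerivWithin_cot_sub_inv_eq_add_mul_tsum (by lia) hz]
  have hs := EisensteinSeries.linear_right_summable z 1 (k := (2 * n + 1 : ℕ) + 1) (by lia)
  have hs' : Summable fun d : ℤ ↦ (z + d) ^ (-1 - (2 * n + 1 : ℕ) : ℤ) :=
    hs.congr fun d ↦ by
      rw [← zpow_neg]; simp only [Int.cast_one, one_mul]; congr 1; ring
  have hn := (summable_int_iff_summable_nat_and_neg.mp hs')
  have h1 := (summable_nat_add_iff 1).2 hn.1
  have h2 := (summable_nat_add_iff 1).2 hn.2
  have ht := tsum_of_add_one_of_neg_add_one (f := fun d : ℤ ↦ (z + d) ^ (-1 - (2 * n + 1 : ℕ) : ℤ))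
    (by simpa using h1) (by simpa using h2)
  have hz1 (w : ℂ) : w ^ (-1 - (2 * n + 1 : ℕ) : ℤ) = (w ^ (2 * n + 1 + 1))⁻¹ := by
    rw [← zpow_natCast, ← zpow_neg]; congr 1; push_cast; ring
  have hodd : (-1 : ℂ) ^ (2 * n + 1) = -1 := Odd.neg_one_pow ⟨n, rfl⟩
  have heven : Even (2 * n + 1 + 1) := ⟨n + 1, by ring⟩
  have := ((h1.hasSum.add h2.hasSum).mul_left (-((2 * n + 1).factorial : ℂ)))
  convert! this using 1
  · ext m
    rw [hz1, hz1, ← heven.neg_pow (_ - z)]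
    push_cast
    rw [show -((m : ℂ) + 1 - z) = z + -(m + 1) by ring, add_comm z (m + 1 : ℂ)]
    ring
  · rw [ht, hodd]
    push_cast
    simp only [add_zero]
    ring

open Real in
theorem stmt12 (n : ℕ) (a : ℝ) (ha : 0 < a) :
    ∫ x in Set.Ioi (0 : ℝ), x ^ (2 * n + 1) * Real.cos (a * x) / (Real.exp x - 1) =
      (-1 : ℝ) ^ n *
        iteratedDeriv (2 * n + 1)
          (fun b : ℝ => π / 2 * coth (b * π) - 1 / (2 * b)) a := by
  have hz : (Complex.I * a : ℂ) ∈ UpperHalfPlane.upperHalfPlaneSet := by simpa using ha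
  have hI : (Complex.I / 2 * Complex.I ^ (2 * n + 1) : ℂ) = ((-(-1) ^ n / 2 : ℝ) : ℂ) := by
    rw [pow_succ, pow_mul, Complex.I_sq]
    push_cast
    linear_combination ((-1) ^ n / 2 : ℂ) * Complex.I_sq
  simp_rw [half_pi_coth_sub_eq_re]
  rw [iteratedDeriv_re_comp_I_mul
    (G := fun z : ℂ ↦ Real.pi * Complex.cot (Real.pi * z) - 1 / z)
    (fun m ↦ contDiffOn_pi_mul_cot_sub_inv m) _ _ ha, hI, Complex.re_ofReal_mul]
  have h1 := Complex.hasSum_re (hasSum_iteratedDerivWithin_cot_sub_inv_odd n hz)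
  have h2 := hasSum_integral_pow_mul_cos_div_exp_sub_one (k := 2 * n + 1) (by lia) a
  have h3 := h1.unique ((h2.mul_left (-2)).congr_fun fun m ↦ ?_)
  · rw [h3]
    have : ((-1 : ℝ) ^ n) * (-1) ^ n = 1 := by rw [← mul_pow]; simp
    linear_combination
      (-∫ x in Set.Ioi (0 : ℝ), x ^ (2 * n + 1) * Real.cos (a * x) / (Real.exp x - 1)) * this
  · have hconj : ((2 * n + 1).factorial / ((m + 1 : ℝ) - Complex.I * a) ^ (2 * n + 1 + 1) : ℂ) =
        starRingEnd ℂ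
          ((2 * n + 1).factorial / ((m + 1 : ℝ) + Complex.I * a) ^ (2 * n + 1 + 1)) := by
      simp [sub_eq_add_neg]
    rw [hconj, Complex.neg_re, Complex.add_re, Complex.conj_re]
    ring
end

section
/- The function t ↦ t²·(ψ(t) - ln t + 1/(2t) + 1/(12t²)) is completely monotonic on (0,∞); consequently ψ(t) - ln t + 1/(2t) + 1/(12t²) has completely monotonic degree at least 2 with respect to t. -/
noncomputable def psi (t : ℝ) : ℝ := deriv (fun x => Real.log (Real.Gamma x)) t

def CompletelyMonotonicOn (h : ℝ → ℝ) : Prop :=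
  ∀ (n : ℕ), ∀ t : ℝ, 0 < t → 0 ≤ (-1 : ℝ) ^ n * iteratedDeriv n h t

open Filter Topology Set MeasureTheory

theorem nonneg_of_tendsto_of_hasDerivAt {f f' : ℝ → ℝ} (h0 : Tendsto f (𝓝[>] 0) (𝓝 0))
    (hd : ∀ x, 0 < x → HasDerivAt f (f' x) x) (hf : ∀ x, 0 < x → 0 ≤ f' x) {x : ℝ}
    (hx : 0 < x) : 0 ≤ f x := by
  have hmono : MonotoneOn f (Ioi 0) := by
    apply monotoneOn_of_deriv_nonneg (convex_Ioi 0)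
    · exact fun y hy => (hd y hy).continuousAt.continuousWithinAt
    · intro y hy
      rw [interior_Ioi] at hy
      exact (hd y hy).differentiableAt.differentiableWithinAt
    · intro y hy
      rw [interior_Ioi] at hy
      rw [(hd y hy).deriv]
      exact hf y hy
  refine le_of_tendsto h0 ?_
  filter_upwards [Ioo_mem_nhdsGT hx] with y hy
  exact hmono hy.1 hx hy.2.le

theorem nonneg_of_hasDerivAt {f f' : ℝ → ℝ} (h0 : f 0 = 0)
    (hd : ∀ x, HasDerivAt f (f' x) x) (hf : ∀ x, 0 < x → 0 ≤ f' x) {x : ℝ}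
    (hx : 0 < x) : 0 ≤ f x := by
  refine nonneg_of_tendsto_of_hasDerivAt ?_ (fun y _ => hd y) hf hx
  have := (hd 0).continuousAt.tendsto
  rw [h0] at this
  exact this.mono_left nhdsWithin_le_nhds

section Hyperbolic

open Real

theorem sinh_le_mul_cosh {u : ℝ} (hu : 0 < u) : sinh u ≤ u * cosh u := by
  have := nonneg_of_hasDerivAt (f := fun x => x * cosh x - sinh x) (f' := fun x => x * sinh x)
    (by simp) (fun x => by
      convert! ((hasDerivAt_id x).mul (hasDerivAt_cosh x)).sub (hasDerivAt_sinh x) using 1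
      simp) (fun x hx => mul_nonneg hx.le (sinh_nonneg_iff.2 hx.le)) hu
  linarith

theorem mul_cosh_sub_sinh_le {u : ℝ} (hu : 0 < u) :
    u * cosh u - sinh u ≤ u ^ 2 * sinh u := by
  have := nonneg_of_hasDerivAt (f := fun x => x ^ 2 * sinh x - (x * cosh x - sinh x))
    (f' := fun x => x * sinh x + x ^ 2 * cosh x)
    (by simp) (fun x => by
      convert! ((hasDerivAt_pow 2 x).mul (hasDerivAt_sinh x)).sub
        (((hasDerivAt_id x).mul (hasDerivAt_cosh x)).sub (hasDerivAt_sinh x)) using 1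
      simp; ring) (fun x hx => by
        have := sinh_pos_iff.2 hx
        have := cosh_pos x
        positivity) hu
  linarith

theorem cosh_le_one_add {u : ℝ} (hu : 0 < u) : cosh u ≤ 1 + u ^ 2 / 2 * cosh u := by
  have := nonneg_of_hasDerivAt (f := fun x => 1 + x ^ 2 / 2 * cosh x - cosh x)
    (f' := fun x => (x * cosh x - sinh x) + x ^ 2 / 2 * sinh x)
    (by simp) (fun x => by
      convert! ((((hasDerivAt_pow 2 x).div_const 2).mul (hasDerivAt_cosh x)).const_add 1).sub
        (hasDerivAt_cosh x) using 1
      simp; ring) (fun x hx => by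
        have := sinh_pos_iff.2 hx
        have := sinh_le_mul_cosh hx
        have : 0 ≤ x ^ 2 / 2 * sinh x := by positivity
        linarith) hu
  linarith

theorem sinh_le_add_cube_mul_cosh {u : ℝ} (hu : 0 < u) :
    sinh u ≤ u + u ^ 3 / 6 * cosh u := by
  have := nonneg_of_hasDerivAt (f := fun x => x + x ^ 3 / 6 * cosh x - sinh x)
    (f' := fun x => (1 + x ^ 2 / 2 * cosh x - cosh x) + x ^ 3 / 6 * sinh x)
    (by simp) (fun x => by
      convert! ((hasDerivAt_id x).add
        (((hasDerivAt_pow 3 x).div_const 6).mul (hasDerivAt_cosh x))).sub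
        (hasDerivAt_sinh x) using 1
      simp; ring) (fun x hx => by
        have := sinh_pos_iff.2 hx
        have := cosh_le_one_add hx
        have : 0 ≤ x ^ 3 / 6 * sinh x := by positivity
        linarith) hu
  linarith

theorem one_add_sq_div_two_le_cosh {u : ℝ} (hu : 0 < u) : 1 + u ^ 2 / 2 ≤ cosh u := by
  have := nonneg_of_hasDerivAt (f := fun x => cosh x - (1 + x ^ 2 / 2))
    (f' := fun x => sinh x - x)
    (by simp) (fun x => by
      convert! (hasDerivAt_cosh x).sub (((hasDerivAt_pow 2 x).div_const 2).const_add 1) using 1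
      simp) (fun x hx => sub_nonneg.2 (self_le_sinh_iff.2 hx.le)) hu
  linarith

theorem add_cube_le_sinh {u : ℝ} (hu : 0 < u) : u + u ^ 3 / 6 ≤ sinh u := by
  have := nonneg_of_hasDerivAt (f := fun x => sinh x - (x + x ^ 3 / 6))
    (f' := fun x => cosh x - (1 + x ^ 2 / 2))
    (by simp) (fun x => by
      convert! (hasDerivAt_sinh x).sub
        ((hasDerivAt_id x).add ((hasDerivAt_pow 3 x).div_const 6)) using 1
      simp; ring) (fun x hx => sub_nonneg.2 (one_add_sq_div_two_le_cosh hx)) hu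
  linarith

theorem three_mul_le_sinh_mul {u : ℝ} (hu : 0 < u) :
    3 * u ≤ sinh u * (2 * cosh u + 1 / cosh u ^ 3) := by
  have := nonneg_of_hasDerivAt
    (f := fun x => 2 * (sinh x * cosh x) + sinh x / cosh x ^ 3 - 3 * x)
    (f' := fun x => (cosh x ^ 2 - 1) ^ 2 * (4 * cosh x ^ 2 + 3) / cosh x ^ 4)
    (by simp) (fun x => by
      have hc := (cosh_pos x).ne'
      convert! ((((hasDerivAt_sinh x).mul (hasDerivAt_cosh x)).const_mul 2).add
        ((hasDerivAt_sinh x).div ((hasDerivAt_cosh x).pow 3) (pow_ne_zero 3 hc))).sub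
        ((hasDerivAt_id x).const_mul 3) using 1
      have h := cosh_sq x
      have h2 : sinh x ^ 2 = cosh x ^ 2 - 1 := by linarith
      simp
      field_simp
      simp only [h2]
      ring) (fun x hx => by positivity) hu
  calc 3 * u ≤ 2 * (sinh u * cosh u) + sinh u / cosh u ^ 3 := by linarith
    _ = _ := by ring

theorem three_mul_sq_le_sinh_sq_mul {u : ℝ} (hu : 0 < u) :
    3 * u ^ 2 ≤ 3 * sinh u ^ 2 - sinh u ^ 4 / cosh u ^ 2 := by
  have := nonneg_of_hasDerivAt
    (f := fun x => 3 * sinh x ^ 2 - sinh x ^ 4 / cosh x ^ 2 - 3 * x ^ 2)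
    (f' := fun x => 2 * (sinh x * (2 * cosh x + 1 / cosh x ^ 3) - 3 * x))
    (by simp) (fun x => by
      have hc := (cosh_pos x).ne'
      convert! ((((hasDerivAt_sinh x).pow 2).const_mul 3).sub
        (((hasDerivAt_sinh x).pow 4).div ((hasDerivAt_cosh x).pow 2) (pow_ne_zero 2 hc))).sub
        ((hasDerivAt_pow 2 x).const_mul 3) using 1
      have h := cosh_sq x
      have h2 : sinh x ^ 2 = cosh x ^ 2 - 1 := by linarith
      field_simp
      simp
      have h5 : sinh x ^ 5 = sinh x * (cosh x ^ 2 - 1) ^ 2 := by rw [← h2]; ring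
      have h3 : sinh x ^ 3 = sinh x * (cosh x ^ 2 - 1) := by rw [← h2]; ring
      ring_nf
      simp only [h3, h5]
      ring) (fun x hx => by have := three_mul_le_sinh_mul hx; linarith) hu
  linarith

/-- Lazarević's inequality. -/
theorem cube_mul_cosh_le_sinh_cube {u : ℝ} (hu : 0 < u) :
    u ^ 3 * cosh u ≤ sinh u ^ 3 := by
  have := nonneg_of_hasDerivAt
    (f := fun x => sinh x ^ 3 / cosh x - x ^ 3)
    (f' := fun x => 3 * sinh x ^ 2 - sinh x ^ 4 / cosh x ^ 2 - 3 * x ^ 2)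
    (by simp) (fun x => by
      have hc := (cosh_pos x).ne'
      convert! (((hasDerivAt_sinh x).pow 3).div (hasDerivAt_cosh x) hc).sub
        (hasDerivAt_pow 3 x) using 1
      field_simp
      simp
      ring) (fun x hx => by have := three_mul_sq_le_sinh_sq_mul hx; linarith) hu
  have hc := cosh_pos u
  rw [← le_div_iff₀ hc]
  linarith

end Hyperbolic

section Kernel

open Real

/-- The Laplace density of `ψ(t) - log t + 1/(2t) + 1/(12t²)`. -/
noncomputable def binetKernel (s : ℝ) : ℝ :=
  s / 12 + 1 / s - cosh (s / 2) / (2 * sinh (s / 2))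

noncomputable def binetKernelDeriv (s : ℝ) : ℝ :=
  1 / 12 - 1 / s ^ 2 + 1 / (4 * sinh (s / 2) ^ 2)

noncomputable def binetKernelDeriv₂ (s : ℝ) : ℝ :=
  2 / s ^ 3 - cosh (s / 2) / (4 * sinh (s / 2) ^ 3)

theorem hasDerivAt_binetKernel {s : ℝ} (hs : 0 < s) :
    HasDerivAt binetKernel (binetKernelDeriv s) s := by
  have hsinh : sinh (s / 2) ≠ 0 := (sinh_pos_iff.2 (by positivity)).ne'
  have hd : HasDerivAt (fun x : ℝ => x / 2) (1 / 2) s := (hasDerivAt_id s).div_const 2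
  convert! (((hasDerivAt_id s).div_const 12).add
    ((hasDerivAt_const s (1 : ℝ)).div (hasDerivAt_id s) hs.ne')).sub
    (hd.cosh.div (hd.sinh.const_mul 2) (mul_ne_zero two_ne_zero hsinh)) using 1
  have h2 : cosh (s / 2) ^ 2 = sinh (s / 2) ^ 2 + 1 := cosh_sq _
  simp only [binetKernelDeriv, id]
  field_simp
  simp only [h2]
  ring

theorem hasDerivAt_binetKernelDeriv {s : ℝ} (hs : 0 < s) :
    HasDerivAt binetKernelDeriv (binetKernelDeriv₂ s) s := by
  have hsinh : sinh (s / 2) ≠ 0 := (sinh_pos_iff.2 (by positivity)).ne'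
  have hd : HasDerivAt (fun x : ℝ => x / 2) (1 / 2) s := (hasDerivAt_id s).div_const 2
  convert! (((hasDerivAt_const s (1 : ℝ)).div (hasDerivAt_pow 2 s)
    (pow_ne_zero 2 hs.ne')).const_sub (1 / 12)).add
    ((hasDerivAt_const s (1 : ℝ)).div ((hd.sinh.pow 2).const_mul 4)
      (mul_ne_zero four_ne_zero (pow_ne_zero 2 hsinh))) using 1
  simp only [binetKernelDeriv₂]
  field_simp
  simp
  ring

theorem binetKernelDeriv₂_nonneg {s : ℝ} (hs : 0 < s) : 0 ≤ binetKernelDeriv₂ s := by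
  have hsinh : 0 < sinh (s / 2) := sinh_pos_iff.2 (by positivity)
  have := cube_mul_cosh_le_sinh_cube (half_pos hs)
  rw [binetKernelDeriv₂, sub_nonneg, div_le_div_iff₀ (by positivity) (by positivity)]
  linarith

theorem binetKernel_le {s : ℝ} (hs : 0 < s) : binetKernel s ≤ s / 12 := by
  have hsinh : 0 < sinh (s / 2) := sinh_pos_iff.2 (by positivity)
  have := sinh_le_mul_cosh (half_pos hs)
  have : 1 / s ≤ cosh (s / 2) / (2 * sinh (s / 2)) := by
    rw [div_le_div_iff₀ (by positivity) (by positivity)]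
    linarith
  rw [binetKernel]
  linarith

theorem le_binetKernel {s : ℝ} (hs : 0 < s) : s / 12 - s / 4 ≤ binetKernel s := by
  have hsinh : 0 < sinh (s / 2) := sinh_pos_iff.2 (by positivity)
  have := mul_cosh_sub_sinh_le (half_pos hs)
  have : cosh (s / 2) / (2 * sinh (s / 2)) ≤ 1 / s + s / 4 := by
    rw [div_le_iff₀ (by positivity)]
    field_simp
    linarith
  rw [binetKernel]
  linarith

theorem binetKernelDeriv_le {s : ℝ} (hs : 0 < s) : binetKernelDeriv s ≤ 1 / 12 := by
  have h := self_le_sinh_iff.2 (half_pos hs).le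
  have : 1 / (4 * sinh (s / 2) ^ 2) ≤ 1 / s ^ 2 := by
    apply one_div_le_one_div_of_le (by positivity)
    nlinarith
  rw [binetKernelDeriv]
  linarith

theorem tendsto_binetKernel_zero : Tendsto binetKernel (𝓝[>] 0) (𝓝 0) := by
  have h1 : Tendsto (fun s : ℝ => s / 12 - s / 4) (𝓝[>] 0) (𝓝 0) := by
    refine (Continuous.tendsto' ?_ 0 0 (by simp)).mono_left nhdsWithin_le_nhds
    fun_prop
  have h2 : Tendsto (fun s : ℝ => s / 12) (𝓝[>] 0) (𝓝 0) := by
    refine (Continuous.tendsto' ?_ 0 0 (by simp)).mono_left nhdsWithin_le_nhds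
    fun_prop
  refine tendsto_of_tendsto_of_tendsto_of_le_of_le' h1 h2 ?_ ?_
  · filter_upwards [self_mem_nhdsWithin] with s hs using le_binetKernel hs
  · filter_upwards [self_mem_nhdsWithin] with s hs using binetKernel_le hs

theorem tendsto_sinh_sub_div_cube :
    Tendsto (fun u => (sinh u - u) / u ^ 3) (𝓝[>] 0) (𝓝 (1 / 6)) := by
  have h2 : Tendsto (fun u : ℝ => cosh u / 6) (𝓝[>] 0) (𝓝 (1 / 6)) := by
    refine (Continuous.tendsto' ?_ 0 _ (by simp)).mono_left nhdsWithin_le_nhds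
    fun_prop
  refine tendsto_of_tendsto_of_tendsto_of_le_of_le' tendsto_const_nhds h2 ?_ ?_
  · filter_upwards [self_mem_nhdsWithin] with u (hu : 0 < u)
    have := add_cube_le_sinh hu
    rw [le_div_iff₀ (by positivity)]
    linarith
  · filter_upwards [self_mem_nhdsWithin] with u (hu : 0 < u)
    have := sinh_le_add_cube_mul_cosh hu
    rw [div_le_iff₀ (by positivity)]
    linarith

theorem tendsto_sinh_div_self : Tendsto (fun u => sinh u / u) (𝓝[>] 0) (𝓝 1) := by
  have h2 : Tendsto (fun u : ℝ => cosh u) (𝓝[>] 0) (𝓝 1) :=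
    (continuous_cosh.tendsto' 0 _ (by simp)).mono_left nhdsWithin_le_nhds
  refine tendsto_of_tendsto_of_tendsto_of_le_of_le' tendsto_const_nhds h2 ?_ ?_
  · filter_upwards [self_mem_nhdsWithin] with u (hu : 0 < u)
    rw [le_div_iff₀ hu, one_mul]
    exact self_le_sinh_iff.2 hu.le
  · filter_upwards [self_mem_nhdsWithin] with u (hu : 0 < u)
    rw [div_le_iff₀ hu, mul_comm]
    exact sinh_le_mul_cosh hu

theorem tendsto_binetKernelDeriv_zero : Tendsto binetKernelDeriv (𝓝[>] 0) (𝓝 0) := by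
  have hhalf : Tendsto (fun s : ℝ => s / 2) (𝓝[>] 0) (𝓝[>] 0) := by
    refine tendsto_nhdsWithin_iff.2 ⟨?_, ?_⟩
    · refine (Continuous.tendsto' ?_ 0 0 (by simp)).mono_left nhdsWithin_le_nhds
      fun_prop
    · filter_upwards [self_mem_nhdsWithin] with s hs using half_pos (mem_Ioi.1 hs)
  have hlim : Tendsto (fun u => 1 / 12 - (sinh u - u) / u ^ 3 * (sinh u / u + 1) /
      (4 * (sinh u / u) ^ 2)) (𝓝[>] 0) (𝓝 0) := by
    have h := tendsto_const_nhds (x := (1 / 12 : ℝ)).sub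
      ((tendsto_sinh_sub_div_cube.mul (tendsto_sinh_div_self.add_const 1)).div
        ((tendsto_sinh_div_self.pow 2).const_mul 4) (by norm_num))
    norm_num at h
    exact h.congr fun u => by norm_num
  refine (hlim.comp hhalf).congr' ?_
  filter_upwards [self_mem_nhdsWithin] with s (hs : 0 < s)
  have hsinh : 0 < sinh (s / 2) := sinh_pos_iff.2 (by positivity)
  simp only [Function.comp, binetKernelDeriv]
  field_simp
  ring

theorem tendsto_binetKernelDeriv_atTop : Tendsto binetKernelDeriv atTop (𝓝 (1 / 12)) := by
  have h2 : Tendsto (fun s : ℝ => 1 / 12 - 1 / s ^ 2) atTop (𝓝 (1 / 12)) := by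
    have := (tendsto_pow_atTop (α := ℝ) two_ne_zero).inv_tendsto_atTop.const_sub (1 / 12)
    simpa using this
  refine tendsto_of_tendsto_of_tendsto_of_le_of_le' h2 tendsto_const_nhds ?_ ?_
  · filter_upwards [eventually_gt_atTop 0] with s hs
    have : 0 ≤ 1 / (4 * sinh (s / 2) ^ 2) := by positivity
    rw [binetKernelDeriv]
    linarith
  · filter_upwards [eventually_gt_atTop 0] with s hs using binetKernelDeriv_le hs

theorem binetKernelDeriv_nonneg {s : ℝ} (hs : 0 < s) : 0 ≤ binetKernelDeriv s :=
  nonneg_of_tendsto_of_hasDerivAt tendsto_binetKernelDeriv_zero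
    (fun _ => hasDerivAt_binetKernelDeriv) (fun _ => binetKernelDeriv₂_nonneg) hs

theorem binetKernel_nonneg {s : ℝ} (hs : 0 < s) : 0 ≤ binetKernel s :=
  nonneg_of_tendsto_of_hasDerivAt tendsto_binetKernel_zero
    (fun _ => hasDerivAt_binetKernel) (fun _ => binetKernelDeriv_nonneg) hs

theorem measurable_binetKernel : Measurable binetKernel := by
  unfold binetKernel; fun_prop

theorem measurable_binetKernelDeriv : Measurable binetKernelDeriv := by
  unfold binetKernelDeriv; fun_prop

theorem measurable_binetKernelDeriv₂ : Measurable binetKernelDeriv₂ := by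
  unfold binetKernelDeriv₂; fun_prop

/-- Multiplying the kernel by `1 - e⁻ˢ` leaves a combination of monomials. -/
theorem mul_binetKernel_mul_one_sub_exp {s : ℝ} (hs : 0 < s) :
    s * binetKernel s * (1 - exp (-s)) =
      (s ^ 2 / 12 + s / 2 + 1) * (1 - exp (-s)) - s := by
  have hsinh : 0 < sinh (s / 2) := sinh_pos_iff.2 (by positivity)
  have h1 : exp (-s) = exp (-(s / 2)) * exp (-(s / 2)) := by rw [← exp_add]; ring_nf
  have h2 : exp (s / 2) * exp (-(s / 2)) = 1 := by rw [← exp_add]; simp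
  have h3 : cosh (s / 2) * (1 - exp (-s)) = sinh (s / 2) * (1 + exp (-s)) := by
    rw [cosh_eq, sinh_eq, h1]
    linear_combination (-exp (-(s / 2))) * h2
  have h4 : cosh (s / 2) / (2 * sinh (s / 2)) * (1 - exp (-s)) = (1 + exp (-s)) / 2 := by
    field_simp
    linear_combination h3
  have h5 : s * (1 / s) = 1 := by field_simp
  rw [binetKernel]
  linear_combination (1 - exp (-s)) * h5 - s * h4

end Kernel

section Laplace

open Real ProbabilityTheory

/-- The Laplace transform of `w` over `(0, ∞)`. -/
noncomputable def laplaceIoi (w : ℝ → ℝ) (t : ℝ) : ℝ := ∫ s in Ioi 0, w s * exp (-(t * s))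

theorem integral_pow_mul_exp_neg_mul (k : ℕ) {t : ℝ} (ht : 0 < t) :
    ∫ s in Ioi 0, s ^ k * exp (-(t * s)) = k.factorial / t ^ (k + 1) := by
  have h := Real.integral_rpow_mul_exp_neg_mul_Ioi (a := (k : ℝ) + 1) (by positivity) ht
  rw [Real.Gamma_nat_eq_factorial, show (k : ℝ) + 1 = ((k + 1 : ℕ) : ℝ) by push_cast; rfl,
    rpow_natCast] at h
  calc _ = (1 / t) ^ (k + 1) * (k.factorial : ℝ) := by
        rw [← h]
        refine setIntegral_congr_fun measurableSet_Ioi fun s _ => ?_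
        simp
    _ = _ := by rw [one_div, inv_pow]; field_simp

theorem integrableOn_pow_mul_exp_neg_mul_s17 (k : ℕ) {t : ℝ} (ht : 0 < t) :
    IntegrableOn (fun s => s ^ k * exp (-(t * s))) (Ioi 0) := by
  by_contra h
  have h0 := integral_undef h
  rw [integral_pow_mul_exp_neg_mul k ht] at h0
  have : (0 : ℝ) < k.factorial / t ^ (k + 1) := by positivity
  exact this.ne' h0

variable {w w' : ℝ → ℝ}

theorem laplaceIoi_eq_mgf (hm : Measurable w) (hw : ∀ s, 0 < s → 0 ≤ w s) :
    laplaceIoi w =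
      mgf (fun s => -s) ((volume.restrict (Ioi 0)).withDensity fun s => ENNReal.ofReal (w s)) := by
  ext t
  rw [mgf, integral_withDensity_eq_integral_toReal_smul hm.ennreal_ofReal (by simp)]
  refine setIntegral_congr_fun measurableSet_Ioi fun s hs => ?_
  simp [ENNReal.toReal_ofReal (hw s hs)]

theorem Ioi_subset_integrableExpSet (hm : Measurable w) (hw : ∀ s, 0 < s → 0 ≤ w s)
    (hi : ∀ t, 0 < t → IntegrableOn (fun s => w s * exp (-(t * s))) (Ioi 0)) :
    Ioi 0 ⊆ interior (integrableExpSet (fun s : ℝ => -s)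
      ((volume.restrict (Ioi 0)).withDensity fun s => ENNReal.ofReal (w s))) := by
  refine interior_maximal (fun t ht => ?_) isOpen_Ioi
  rw [integrableExpSet, mem_ofPred_eq,
    integrable_withDensity_iff_integrable_smul' hm.ennreal_ofReal (by simp)]
  refine (hi t ht).congr_fun (fun s hs => ?_) measurableSet_Ioi
  simp [ENNReal.toReal_ofReal (hw s hs)]

theorem iteratedDeriv_laplaceIoi (hm : Measurable w) (hw : ∀ s, 0 < s → 0 ≤ w s)
    (hi : ∀ t, 0 < t → IntegrableOn (fun s => w s * exp (-(t * s))) (Ioi 0))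
    (n : ℕ) {t : ℝ} (ht : 0 < t) :
    iteratedDeriv n (laplaceIoi w) t =
      ∫ s in Ioi 0, w s * ((-s) ^ n * exp (-(t * s))) := by
  rw [laplaceIoi_eq_mgf hm hw, iteratedDeriv_mgf (Ioi_subset_integrableExpSet hm hw hi ht),
    integral_withDensity_eq_integral_toReal_smul hm.ennreal_ofReal (by simp)]
  refine setIntegral_congr_fun measurableSet_Ioi fun s hs => ?_
  simp [ENNReal.toReal_ofReal (hw s hs)]

theorem differentiableAt_laplaceIoi (hm : Measurable w) (hw : ∀ s, 0 < s → 0 ≤ w s)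
    (hi : ∀ t, 0 < t → IntegrableOn (fun s => w s * exp (-(t * s))) (Ioi 0))
    {t : ℝ} (ht : 0 < t) : DifferentiableAt ℝ (laplaceIoi w) t := by
  rw [laplaceIoi_eq_mgf hm hw]
  exact differentiableAt_mgf (Ioi_subset_integrableExpSet hm hw hi ht)

theorem hasDerivAt_laplaceIoi (hm : Measurable w) (hw : ∀ s, 0 < s → 0 ≤ w s)
    (hi : ∀ t, 0 < t → IntegrableOn (fun s => w s * exp (-(t * s))) (Ioi 0))
    {t : ℝ} (ht : 0 < t) :
    HasDerivAt (laplaceIoi w) (-∫ s in Ioi 0, s * w s * exp (-(t * s))) t := by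
  convert! (differentiableAt_laplaceIoi hm hw hi ht).hasDerivAt using 1
  rw [← iteratedDeriv_one, iteratedDeriv_laplaceIoi hm hw hi 1 ht, ← integral_neg]
  congr 1
  ext s
  ring

theorem completelyMonotonicOn_laplaceIoi (hm : Measurable w) (hw : ∀ s, 0 < s → 0 ≤ w s)
    (hi : ∀ t, 0 < t → IntegrableOn (fun s => w s * exp (-(t * s))) (Ioi 0)) :
    CompletelyMonotonicOn (laplaceIoi w) := by
  intro n t ht
  rw [iteratedDeriv_laplaceIoi hm hw hi n ht, ← integral_const_mul]
  refine setIntegral_nonneg measurableSet_Ioi fun s (hs : 0 < s) => ?_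
  have h : (-1 : ℝ) ^ n * (w s * ((-s) ^ n * exp (-(t * s)))) =
      ((-1) ^ n * (-s) ^ n) * (w s * exp (-(t * s))) := by ring
  rw [h, ← mul_pow]
  have := hw s hs
  have : 0 ≤ -1 * -s := by linarith
  positivity

theorem mul_laplaceIoi_eq {t : ℝ} (hd : ∀ s, 0 < s → HasDerivAt w (w' s) s)
    (hi : IntegrableOn (fun s => w s * exp (-(t * s))) (Ioi 0))
    (hi' : IntegrableOn (fun s => w' s * exp (-(t * s))) (Ioi 0))
    (h0 : Tendsto w (𝓝[>] 0) (𝓝 0))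
    (htop : Tendsto (fun s => w s * exp (-(t * s))) atTop (𝓝 0)) :
    t * laplaceIoi w t = laplaceIoi w' t := by
  have hexp : ∀ s : ℝ, HasDerivAt (fun s => exp (-(t * s))) (exp (-(t * s)) * -t) s := fun s => by
    simpa using (((hasDerivAt_id s).const_mul t).neg).exp
  have hi2 : IntegrableOn (fun s => w s * (exp (-(t * s)) * -t)) (Ioi 0) :=
    (Integrable.mul_const hi (-t)).congr (Eventually.of_forall fun s => by ring)
  have h := integral_Ioi_deriv_mul_eq_sub (a := 0) (a' := 0) (b' := 0)
    (u := w) (v := fun s => exp (-(t * s)))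
    (fun s hs => hd s hs) (fun s _ => hexp s) (hi'.add hi2)
    (by
      have : Tendsto (fun s => exp (-(t * s))) (𝓝[>] 0) (𝓝 1) := by
        refine (Continuous.tendsto' ?_ 0 _ (by simp)).mono_left nhdsWithin_le_nhds
        fun_prop
      have h := h0.mul this
      rw [zero_mul] at h
      exact h) htop
  rw [integral_add hi' hi2] at h
  have h2 : ∫ s in Ioi 0, w s * (exp (-(t * s)) * -t) = -t * laplaceIoi w t := by
    rw [laplaceIoi, ← integral_const_mul]
    congr 1
    ext s
    ring
  rw [h2, ← laplaceIoi] at h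
  linarith

end Laplace

section BinetLaplace

open Real

theorem continuousWithinAt_update_binetKernelDeriv :
    ContinuousWithinAt (Function.update binetKernelDeriv 0 0) (Ici 0) 0 := by
  rw [continuousWithinAt_update_same, Ici_sdiff_left]
  exact tendsto_binetKernelDeriv_zero

theorem hasDerivAt_update_binetKernelDeriv {s : ℝ} (hs : 0 < s) :
    HasDerivAt (Function.update binetKernelDeriv 0 0) (binetKernelDeriv₂ s) s := by
  refine (hasDerivAt_binetKernelDeriv hs).congr_of_eventuallyEq ?_
  filter_upwards [eventually_ne_nhds hs.ne'] with y hy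
  exact Function.update_of_ne hy _ _

theorem tendsto_update_binetKernelDeriv_atTop :
    Tendsto (Function.update binetKernelDeriv 0 0) atTop (𝓝 (1 / 12)) := by
  refine tendsto_binetKernelDeriv_atTop.congr' ?_
  filter_upwards [eventually_ne_atTop 0] with y hy
  exact (Function.update_of_ne hy _ _).symm

theorem integrableOn_binetKernelDeriv₂ : IntegrableOn binetKernelDeriv₂ (Ioi 0) :=
  integrableOn_Ioi_deriv_of_nonneg continuousWithinAt_update_binetKernelDeriv
    (fun _ => hasDerivAt_update_binetKernelDeriv) (fun _ => binetKernelDeriv₂_nonneg)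
    tendsto_update_binetKernelDeriv_atTop

theorem integral_binetKernelDeriv₂ : ∫ s in Ioi 0, binetKernelDeriv₂ s = 1 / 12 := by
  rw [integral_Ioi_of_hasDerivAt_of_nonneg continuousWithinAt_update_binetKernelDeriv
    (fun _ => hasDerivAt_update_binetKernelDeriv) (fun _ => binetKernelDeriv₂_nonneg)
    tendsto_update_binetKernelDeriv_atTop]
  simp

variable {t : ℝ}

theorem integrableOn_binetKernelDeriv₂_mul_exp (ht : 0 < t) :
    IntegrableOn (fun s => binetKernelDeriv₂ s * exp (-(t * s))) (Ioi 0) := by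
  refine integrableOn_binetKernelDeriv₂.mono'
    (measurable_binetKernelDeriv₂.mul (by fun_prop)).aestronglyMeasurable ?_
  filter_upwards [ae_restrict_mem measurableSet_Ioi] with s (hs : 0 < s)
  have := binetKernelDeriv₂_nonneg hs
  rw [norm_of_nonneg (by positivity)]
  exact mul_le_of_le_one_right this (exp_le_one_iff.2 (by nlinarith))

theorem integrableOn_binetKernelDeriv_mul_exp (ht : 0 < t) :
    IntegrableOn (fun s => binetKernelDeriv s * exp (-(t * s))) (Ioi 0) := by
  refine ((integrableOn_pow_mul_exp_neg_mul_s17 0 ht).const_mul (1 / 12)).mono'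
    (measurable_binetKernelDeriv.mul (by fun_prop)).aestronglyMeasurable ?_
  filter_upwards [ae_restrict_mem measurableSet_Ioi] with s (hs : 0 < s)
  have := binetKernelDeriv_nonneg hs
  rw [norm_of_nonneg (by positivity), pow_zero, one_mul]
  gcongr
  exact binetKernelDeriv_le hs

theorem binetKernel_mul_exp_le {s : ℝ} (hs : 0 < s) :
    binetKernel s * exp (-(t * s)) ≤ 1 / 12 * (s ^ 1 * exp (-(t * s))) := by
  have := mul_le_mul_of_nonneg_right (binetKernel_le hs) (exp_pos (-(t * s))).le
  linarith

theorem integrableOn_binetKernel_mul_exp (ht : 0 < t) :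
    IntegrableOn (fun s => binetKernel s * exp (-(t * s))) (Ioi 0) := by
  refine ((integrableOn_pow_mul_exp_neg_mul_s17 1 ht).const_mul (1 / 12)).mono'
    (measurable_binetKernel.mul (by fun_prop)).aestronglyMeasurable ?_
  filter_upwards [ae_restrict_mem measurableSet_Ioi] with s (hs : 0 < s)
  have := binetKernel_nonneg hs
  rw [norm_of_nonneg (by positivity)]
  exact binetKernel_mul_exp_le hs

theorem tendsto_pow_mul_exp_neg_mul (k : ℕ) (ht : 0 < t) :
    Tendsto (fun s => s ^ k * exp (-(t * s))) atTop (𝓝 0) := by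
  simpa using tendsto_rpow_mul_exp_neg_mul_atTop_nhds_zero k t ht

theorem sq_mul_laplaceIoi_binetKernel (ht : 0 < t) :
    t ^ 2 * laplaceIoi binetKernel t = laplaceIoi binetKernelDeriv₂ t := by
  have h1 : t * laplaceIoi binetKernel t = laplaceIoi binetKernelDeriv t := by
    refine mul_laplaceIoi_eq (fun _ => hasDerivAt_binetKernel)
      (integrableOn_binetKernel_mul_exp ht) (integrableOn_binetKernelDeriv_mul_exp ht)
      tendsto_binetKernel_zero ?_
    refine tendsto_of_tendsto_of_tendsto_of_le_of_le' tendsto_const_nhds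
      (by simpa using (tendsto_pow_mul_exp_neg_mul 1 ht).const_mul (1 / 12)) ?_ ?_
    · filter_upwards [eventually_gt_atTop 0] with s hs
      exact mul_nonneg (binetKernel_nonneg hs) (exp_pos _).le
    · filter_upwards [eventually_gt_atTop 0] with s hs
      simpa using binetKernel_mul_exp_le hs
  have h2 : t * laplaceIoi binetKernelDeriv t = laplaceIoi binetKernelDeriv₂ t := by
    refine mul_laplaceIoi_eq (fun _ => hasDerivAt_binetKernelDeriv)
      (integrableOn_binetKernelDeriv_mul_exp ht) (integrableOn_binetKernelDeriv₂_mul_exp ht)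
      tendsto_binetKernelDeriv_zero ?_
    simpa using tendsto_binetKernelDeriv_atTop.mul (tendsto_pow_mul_exp_neg_mul 0 ht)
  rw [pow_two, mul_assoc, h1, h2]

theorem laplaceIoi_binetKernel_nonneg : 0 ≤ laplaceIoi binetKernel t :=
  setIntegral_nonneg measurableSet_Ioi fun _ hs =>
    mul_nonneg (binetKernel_nonneg hs) (exp_pos _).le

theorem laplaceIoi_binetKernelDeriv₂_le (ht : 0 < t) :
    laplaceIoi binetKernelDeriv₂ t ≤ 1 / 12 := by
  rw [← integral_binetKernelDeriv₂]
  refine setIntegral_mono_on (integrableOn_binetKernelDeriv₂_mul_exp ht)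
    integrableOn_binetKernelDeriv₂ measurableSet_Ioi fun s (hs : 0 < s) => ?_
  exact mul_le_of_le_one_right (binetKernelDeriv₂_nonneg hs) (exp_le_one_iff.2 (by nlinarith))

theorem laplaceIoi_binetKernelDeriv₂_pos (ht : 0 < t) :
    0 < laplaceIoi binetKernelDeriv₂ t := by
  have hpos : 0 < ∫ s in Ioi 0, binetKernelDeriv₂ s := by
    rw [integral_binetKernelDeriv₂]; norm_num
  have hnn : 0 ≤ᵐ[volume.restrict (Ioi 0)] binetKernelDeriv₂ := by
    filter_upwards [ae_restrict_mem measurableSet_Ioi] with s hs using binetKernelDeriv₂_nonneg hs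
  rw [integral_pos_iff_support_of_nonneg_ae hnn integrableOn_binetKernelDeriv₂] at hpos
  rw [laplaceIoi, integral_pos_iff_support_of_nonneg_ae ?_
    (integrableOn_binetKernelDeriv₂_mul_exp ht)]
  · convert hpos using 2
    ext s
    simp [(exp_pos _).ne']
  · filter_upwards [hnn] with s hs using mul_nonneg hs (exp_pos _).le

theorem tendsto_laplaceIoi_binetKernel_atTop :
    Tendsto (laplaceIoi binetKernel) atTop (𝓝 0) := by
  have h2 : Tendsto (fun t : ℝ => (12 : ℝ)⁻¹ * (t ^ 2)⁻¹) atTop (𝓝 0) := by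
    simpa using (tendsto_pow_atTop (α := ℝ) two_ne_zero).inv_tendsto_atTop.const_mul (12 : ℝ)⁻¹
  refine tendsto_of_tendsto_of_tendsto_of_le_of_le' tendsto_const_nhds h2 ?_ ?_
  · exact Eventually.of_forall fun t => laplaceIoi_binetKernel_nonneg
  · filter_upwards [eventually_gt_atTop 0] with t ht
    have h := laplaceIoi_binetKernelDeriv₂_le ht
    rw [← sq_mul_laplaceIoi_binetKernel ht] at h
    rw [← div_eq_mul_inv, le_div_iff₀ (by positivity)]
    linarith

end BinetLaplace

section Psi

open Real

theorem differentiableAt_log_Gamma {t : ℝ} (ht : 0 < t) :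
    DifferentiableAt ℝ (fun x => Real.log (Real.Gamma x)) t := by
  refine (Real.differentiableAt_Gamma fun m => ?_).log (Real.Gamma_pos_of_pos ht).ne'
  have : (0 : ℝ) ≤ m := by positivity
  linarith

theorem psi_add_one {t : ℝ} (ht : 0 < t) : psi (t + 1) = psi t + 1 / t := by
  rw [psi, ← deriv_comp_add_const]
  have h : (fun x => log (Gamma (x + 1))) =ᶠ[𝓝 t] fun x => log (Gamma x) + log x := by
    filter_upwards [eventually_gt_nhds ht] with x hx
    rw [Gamma_add_one hx.ne', log_mul hx.ne' (Gamma_pos_of_pos hx).ne', add_comm]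
  rw [h.deriv_eq]
  rw [deriv_fun_add (differentiableAt_log_Gamma ht) (differentiableAt_log ht.ne'), deriv_log,
    one_div, psi]

theorem log_Gamma_add_one_sub {t : ℝ} (ht : 0 < t) :
    log (Gamma (t + 1)) - log (Gamma t) = log t := by
  rw [Gamma_add_one ht.ne', log_mul ht.ne' (Gamma_pos_of_pos ht).ne']
  ring

theorem psi_le_log {t : ℝ} (ht : 0 < t) : psi t ≤ log t := by
  have h := convexOn_log_Gamma.deriv_le_slope (mem_Ioi.2 ht)
    (mem_Ioi.2 (by linarith : 0 < t + 1)) (by linarith) (differentiableAt_log_Gamma ht)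
  rw [slope_def_field] at h
  simpa [log_Gamma_add_one_sub ht, psi, Function.comp_def] using h

theorem log_le_psi_add_one {t : ℝ} (ht : 0 < t) : log t ≤ psi (t + 1) := by
  have h := convexOn_log_Gamma.slope_le_deriv (mem_Ioi.2 ht)
    (mem_Ioi.2 (by linarith : 0 < t + 1)) (by linarith)
    (differentiableAt_log_Gamma (by linarith))
  rw [slope_def_field] at h
  simpa [log_Gamma_add_one_sub ht, psi, Function.comp_def] using h

theorem tendsto_psi_sub_log : Tendsto (fun t => psi t - log t) atTop (𝓝 0) := by
  have h1 : Tendsto (fun t : ℝ => -t⁻¹) atTop (𝓝 0) := by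
    simpa using tendsto_inv_atTop_zero.neg (G := ℝ)
  refine tendsto_of_tendsto_of_tendsto_of_le_of_le' h1 tendsto_const_nhds ?_ ?_
  · filter_upwards [eventually_gt_atTop 0] with t ht
    have := log_le_psi_add_one ht
    rw [psi_add_one ht, one_div] at this
    linarith
  · filter_upwards [eventually_gt_atTop 0] with t ht
    linarith [psi_le_log ht]

theorem eq_zero_of_periodic_of_tendsto {f : ℝ → ℝ} (hf : ∀ t, 0 < t → f (t + 1) = f t)
    (h0 : Tendsto f atTop (𝓝 0)) {t : ℝ} (ht : 0 < t) : f t = 0 := by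
  have hn : ∀ n : ℕ, f (t + n) = f t := by
    intro n
    induction n with
    | zero => simp
    | succ n ih =>
      rw [Nat.cast_succ, ← add_assoc, hf _ (by positivity), ih]
  have h := h0.comp (tendsto_atTop_add_const_left _ t tendsto_natCast_atTop_atTop)
  exact tendsto_nhds_unique (tendsto_const_nhds.congr fun n => (hn n).symm) h

theorem eq_zero_of_hasDerivAt_zero_of_tendsto {f : ℝ → ℝ}
    (hf : ∀ t, 0 < t → HasDerivAt f 0 t)
    (h0 : Tendsto f atTop (𝓝 0)) {t : ℝ} (ht : 0 < t) : f t = 0 := by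
  have hc : ∀ s, 0 < s → f s = f t := fun s hs =>
    isOpen_Ioi.is_const_of_deriv_eq_zero isPreconnected_Ioi
      (fun x hx => (hf x hx).differentiableAt.differentiableWithinAt)
      (fun x hx => (hf x hx).deriv) hs ht
  refine tendsto_nhds_unique (tendsto_const_nhds.congr' ?_) h0
  filter_upwards [eventually_gt_atTop 0] with s hs using (hc s hs).symm

/-- The remainder after two terms of the asymptotic expansion of `ψ`. -/
noncomputable def psiRemainder (t : ℝ) : ℝ :=
  psi t - Real.log t + 1 / (2 * t) + 1 / (12 * t ^ 2)

noncomputable def psiRemainderDiff (t : ℝ) : ℝ :=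
  log (t + 1) - log t - 1 / (2 * t) - 1 / (2 * (t + 1)) +
    (1 / (12 * t ^ 2) - 1 / (12 * (t + 1) ^ 2))

theorem psiRemainder_sub_add_one {t : ℝ} (ht : 0 < t) :
    psiRemainder t - psiRemainder (t + 1) = psiRemainderDiff t := by
  rw [psiRemainder, psiRemainder, psiRemainderDiff, psi_add_one ht]
  field_simp
  ring

theorem hasDerivAt_psiRemainderDiff {t : ℝ} (ht : 0 < t) :
    HasDerivAt psiRemainderDiff (1 / (t + 1) - 1 / t + 1 / (2 * t ^ 2) + 1 / (2 * (t + 1) ^ 2) -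
      (1 / (6 * t ^ 3) - 1 / (6 * (t + 1) ^ 3))) t := by
  have h1 : HasDerivAt (fun x : ℝ => x + 1) 1 t := (hasDerivAt_id t).add_const 1
  have h1' : t + 1 ≠ 0 := by positivity
  have hc := hasDerivAt_const t (1 : ℝ)
  convert! ((((h1.log h1').sub (hasDerivAt_log ht.ne')).sub
    (hc.div ((hasDerivAt_id t).const_mul 2) (by simp [ht.ne']))).sub
    (hc.div (h1.const_mul 2) (by simp [h1']))).add
    ((hc.div ((hasDerivAt_pow 2 t).const_mul 12) (by simp [ht.ne'])).sub
    (hc.div ((h1.pow 2).const_mul 12) (by simp [h1']))) using 1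
  simp only [id]
  field_simp
  simp
  ring

theorem tendsto_inv_mul_pow_atTop (c : ℝ) {k : ℕ} (hk : k ≠ 0) :
    Tendsto (fun t : ℝ => 1 / (c * t ^ k)) atTop (𝓝 0) := by
  have := (tendsto_pow_atTop (α := ℝ) hk).inv_tendsto_atTop.const_mul c⁻¹
  rw [mul_zero] at this
  exact this.congr fun t => by simp [mul_comm]

theorem tendsto_psiRemainder_atTop : Tendsto psiRemainder atTop (𝓝 0) := by
  have h := (tendsto_psi_sub_log.add (tendsto_inv_mul_pow_atTop 2 one_ne_zero)).add
    (tendsto_inv_mul_pow_atTop 12 two_ne_zero)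
  simp only [pow_one, add_zero] at h
  exact h

theorem tendsto_psiRemainderDiff_atTop : Tendsto psiRemainderDiff atTop (𝓝 0) := by
  have h := tendsto_psiRemainder_atTop.sub
    (tendsto_psiRemainder_atTop.comp (tendsto_atTop_add_const_right _ 1 tendsto_id))
  rw [sub_zero] at h
  refine h.congr' ?_
  filter_upwards [eventually_gt_atTop 0] with t ht using psiRemainder_sub_add_one ht

theorem integrableOn_mul_binetKernel_mul_exp {t : ℝ} (ht : 0 < t) :
    IntegrableOn (fun s => s * binetKernel s * exp (-(t * s))) (Ioi 0) := by
  refine ((integrableOn_pow_mul_exp_neg_mul_s17 2 ht).const_mul (1 / 12)).mono'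
    ((measurable_id.mul measurable_binetKernel).mul (by fun_prop)).aestronglyMeasurable ?_
  filter_upwards [ae_restrict_mem measurableSet_Ioi] with s (hs : 0 < s)
  have := binetKernel_nonneg hs
  rw [norm_of_nonneg (by positivity), mul_assoc]
  calc s * (binetKernel s * exp (-(t * s)))
      ≤ s * (1 / 12 * (s ^ 1 * exp (-(t * s)))) :=
        mul_le_mul_of_nonneg_left (binetKernel_mul_exp_le hs) hs.le
    _ = _ := by ring

theorem integral_mul_binetKernel_sub {t : ℝ} (ht : 0 < t) :
    (∫ s in Ioi 0, s * binetKernel s * exp (-(t * s))) -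
      ∫ s in Ioi 0, s * binetKernel s * exp (-((t + 1) * s)) =
    (1 / (6 * t ^ 3) - 1 / (6 * (t + 1) ^ 3)) - 1 / (2 * t ^ 2) - 1 / (2 * (t + 1) ^ 2) +
      (1 / t - 1 / (t + 1)) := by
  have ht1 : 0 < t + 1 := by positivity
  have hi := fun k : ℕ => integrableOn_pow_mul_exp_neg_mul_s17 k ht
  have hi1 := fun k : ℕ => integrableOn_pow_mul_exp_neg_mul_s17 k ht1
  have hI := fun k : ℕ => integral_pow_mul_exp_neg_mul k ht
  have hI1 := fun k : ℕ => integral_pow_mul_exp_neg_mul k ht1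
  rw [← integral_sub (integrableOn_mul_binetKernel_mul_exp ht)
    (integrableOn_mul_binetKernel_mul_exp ht1)]
  have hcongr : ∫ s in Ioi 0, (s * binetKernel s * exp (-(t * s)) -
      s * binetKernel s * exp (-((t + 1) * s))) =
      ∫ s in Ioi 0, (1 / 12 * (s ^ 2 * exp (-(t * s)) - s ^ 2 * exp (-((t + 1) * s))) +
        (-1 / 2 * (s ^ 1 * exp (-(t * s))) - 1 / 2 * (s ^ 1 * exp (-((t + 1) * s)))) +
        (s ^ 0 * exp (-(t * s)) - s ^ 0 * exp (-((t + 1) * s)))) := by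
    refine setIntegral_congr_fun measurableSet_Ioi fun s (hs : 0 < s) => ?_
    have h1 : exp (-((t + 1) * s)) = exp (-(t * s)) * exp (-s) := by
      rw [← exp_add]; ring_nf
    simp only [h1]
    linear_combination exp (-(t * s)) * mul_binetKernel_mul_one_sub_exp hs
  have hA : IntegrableOn (fun s => 1 / 12 * (s ^ 2 * exp (-(t * s)) -
      s ^ 2 * exp (-((t + 1) * s)))) (Ioi 0) := ((hi 2).sub (hi1 2)).const_mul _
  have hB : IntegrableOn (fun s => -1 / 2 * (s ^ 1 * exp (-(t * s))) -
      1 / 2 * (s ^ 1 * exp (-((t + 1) * s)))) (Ioi 0) :=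
    ((hi 1).const_mul _).sub ((hi1 1).const_mul _)
  have hAB : IntegrableOn (fun s => 1 / 12 * (s ^ 2 * exp (-(t * s)) -
      s ^ 2 * exp (-((t + 1) * s))) + (-1 / 2 * (s ^ 1 * exp (-(t * s))) -
      1 / 2 * (s ^ 1 * exp (-((t + 1) * s))))) (Ioi 0) := hA.add hB
  have hC : IntegrableOn (fun s => s ^ 0 * exp (-(t * s)) - s ^ 0 * exp (-((t + 1) * s)))
    (Ioi 0) := (hi 0).sub (hi1 0)
  rw [hcongr, integral_add hAB hC, integral_add hA hB, integral_const_mul,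
    integral_sub (hi 2) (hi1 2), integral_sub ((hi 1).const_mul _) ((hi1 1).const_mul _),
    integral_const_mul, integral_const_mul, integral_sub (hi 0) (hi1 0)]
  simp only [hI, hI1, Nat.factorial]
  push_cast
  field_simp
  ring

theorem laplaceIoi_binetKernel_sub_add_one {t : ℝ} (ht : 0 < t) :
    laplaceIoi binetKernel t - laplaceIoi binetKernel (t + 1) = psiRemainderDiff t := by
  rw [← sub_eq_zero]
  refine eq_zero_of_hasDerivAt_zero_of_tendsto (f := fun t => laplaceIoi binetKernel t -
    laplaceIoi binetKernel (t + 1) - psiRemainderDiff t) (fun x hx => ?_) ?_ ht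
  · have hL := fun y (hy : 0 < y) => hasDerivAt_laplaceIoi measurable_binetKernel
      (fun _ => binetKernel_nonneg) (fun _ => integrableOn_binetKernel_mul_exp) (t := y) hy
    convert! ((hL x hx).sub ((hL (x + 1) (by positivity)).comp_add_const x 1)).sub
      (hasDerivAt_psiRemainderDiff hx) using 1
    linear_combination integral_mul_binetKernel_sub hx
  · have hL := tendsto_laplaceIoi_binetKernel_atTop
    simpa using (hL.sub (hL.comp (tendsto_atTop_add_const_right _ 1 tendsto_id))).sub
      tendsto_psiRemainderDiff_atTop

/-- Binet's integral formula for `ψ`. -/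
theorem psiRemainder_eq_laplaceIoi {t : ℝ} (ht : 0 < t) :
    psiRemainder t = laplaceIoi binetKernel t := by
  rw [← sub_eq_zero]
  refine eq_zero_of_periodic_of_tendsto
    (f := fun t => psiRemainder t - laplaceIoi binetKernel t) (fun x hx => ?_) ?_ ht
  · linear_combination laplaceIoi_binetKernel_sub_add_one hx - psiRemainder_sub_add_one hx
  · simpa using tendsto_psiRemainder_atTop.sub tendsto_laplaceIoi_binetKernel_atTop

theorem sq_mul_psiRemainder {t : ℝ} (ht : 0 < t) :
    t ^ 2 * psiRemainder t = laplaceIoi binetKernelDeriv₂ t := by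
  rw [psiRemainder_eq_laplaceIoi ht, sq_mul_laplaceIoi_binetKernel ht]

end Psi

theorem CompletelyMonotonicOn.congr {f g : ℝ → ℝ} (hf : CompletelyMonotonicOn f)
    (h : ∀ t, 0 < t → f t = g t) : CompletelyMonotonicOn g := by
  intro n t ht
  have he : f =ᶠ[𝓝 t] g := by
    filter_upwards [eventually_gt_nhds ht] with x hx using h x hx
  rw [← he.iteratedDeriv_eq n]
  exact hf n t ht

theorem CompletelyMonotonicOn.antitoneOn {f : ℝ → ℝ} (hf : CompletelyMonotonicOn f)
    (hd : ∀ t, 0 < t → DifferentiableAt ℝ f t) : AntitoneOn f (Ioi 0) := by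
  apply antitoneOn_of_deriv_nonpos (convex_Ioi 0)
  · exact fun t ht => (hd t ht).continuousAt.continuousWithinAt
  · intro t ht
    rw [interior_Ioi] at ht
    exact (hd t ht).differentiableWithinAt
  · intro t ht
    rw [interior_Ioi] at ht
    have := hf 1 t ht
    rw [iteratedDeriv_one] at this
    linarith

theorem completelyMonotonicOn_sq_mul_psiRemainder :
    CompletelyMonotonicOn (fun t => t ^ 2 * psiRemainder t) :=
  (completelyMonotonicOn_laplaceIoi measurable_binetKernelDeriv₂
    (fun _ => binetKernelDeriv₂_nonneg)
    (fun _ => integrableOn_binetKernelDeriv₂_mul_exp)).congr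
    fun _ ht => (sq_mul_psiRemainder ht).symm

theorem le_two_of_completelyMonotonicOn_rpow_mul_psiRemainder {α : ℝ}
    (h : CompletelyMonotonicOn (fun t => t ^ α * psiRemainder t)) : α ≤ 2 := by
  by_contra! hα
  have heq : ∀ t : ℝ, 0 < t → t ^ α * psiRemainder t =
      t ^ (α - 2) * laplaceIoi binetKernelDeriv₂ t := fun t ht => by
    rw [← sq_mul_psiRemainder ht, ← mul_assoc, ← Real.rpow_natCast, ← Real.rpow_add ht]
    norm_num
  have hanti := (h.congr heq).antitoneOn fun t ht =>
    (Real.differentiableAt_rpow_const_of_ne _ ht.ne').mul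
      (differentiableAt_laplaceIoi measurable_binetKernelDeriv₂
        (fun _ => binetKernelDeriv₂_nonneg)
        (fun _ => integrableOn_binetKernelDeriv₂_mul_exp) ht)
  have hlim : Tendsto (fun t : ℝ => t ^ (α - 2) * (1 / 12)) (𝓝[>] 0) (𝓝 0) := by
    have hc := (Real.continuousAt_rpow_const 0 (α - 2) (Or.inr (by linarith))).tendsto
    rw [Real.zero_rpow (by linarith)] at hc
    have hc' := (hc.mono_left (nhdsWithin_le_nhds (s := Ioi 0))).mul_const (1 / 12)
    rwa [zero_mul] at hc'
  have hle : laplaceIoi binetKernelDeriv₂ 1 ≤ 0 := by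
    refine ge_of_tendsto hlim ?_
    filter_upwards [Ioo_mem_nhdsGT one_pos] with t ht
    have h1 := hanti ht.1 (mem_Ioi.2 one_pos) ht.2.le
    simp only [Real.one_rpow, one_mul] at h1
    exact h1.trans (mul_le_mul_of_nonneg_left (laplaceIoi_binetKernelDeriv₂_le ht.1)
      (Real.rpow_nonneg ht.1.le _))
  exact (laplaceIoi_binetKernelDeriv₂_pos one_pos).not_ge hle

theorem stmt17 :
    CompletelyMonotonicOn
      (fun t => t ^ 2 * (psi t - Real.log t + 1 / (2 * t) + 1 / (12 * t ^ 2))) ∧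
    2 ≤ sSup {α : ℝ | 0 ≤ α ∧
      CompletelyMonotonicOn
        (fun t => t ^ α *
          (psi t - Real.log t + 1 / (2 * t) + 1 / (12 * t ^ 2)))} := by
  refine ⟨completelyMonotonicOn_sq_mul_psiRemainder, le_csSup ⟨2, fun α hα =>
    le_two_of_completelyMonotonicOn_rpow_mul_psiRemainder hα.2⟩ ⟨zero_le_two, ?_⟩⟩
  exact completelyMonotonicOn_sq_mul_psiRemainder.congr fun t _ => by
    rw [Real.rpow_two, psiRemainder]
end
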